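/- arXiv:2603.13454 — 10 statements merged into one kernel-verified Lean document; each statement's English description precedes it below -/
import Mathlib

section
/- Let N ≥ 1 and let M₁, M₂ be N×N complex matrices. Then C(M₁) * (C(M₂) ⊗ I₂) * (I_N ⊗ Δ) = C(M₁ * M₂), up to the canonical re-indexing equivalences; i.e., composing the controlled matrices of M₁ and M₂ in sequence with their control wires fused by the copy map Δ yields the controlled matrix of the product M₁M₂. -/
open Matrix
open scoped Kronecker

/-- The controlled matrix of an `N × N` complex matrix `M`:
column `(j, 0)` is the standard basis column `e_j`, column `(j, 1)` is column `j` of `M`. -/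
noncomputable def ctrlMat {N : ℕ} (M : Matrix (Fin N) (Fin N) ℂ) :
    Matrix (Fin N) (Fin N × Fin 2) ℂ :=
  fun i jb => if jb.2 = 0 then (if i = jb.1 then (1 : ℂ) else 0) else M i jb.1

/-- The copy map `Δ : |c⟩ ↦ |cc⟩`. -/
noncomputable def copyMat : Matrix (Fin 2 × Fin 2) (Fin 2) ℂ :=
  fun ab c => if ab.1 = c ∧ ab.2 = c then 1 else 0

/-- Right multiplication by the reindexed `I_N ⊗ Δ` duplicates the control value. -/
theorem mul_reindex_one_kronecker_copyMat {N : ℕ} {m : Type*}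
    (A : Matrix m ((Fin N × Fin 2) × Fin 2) ℂ) (i : m) (j : Fin N) (b : Fin 2) :
    (A * (Matrix.reindex (Equiv.prodAssoc (Fin N) (Fin 2) (Fin 2)).symm
        (Equiv.refl (Fin N × Fin 2))
        ((1 : Matrix (Fin N) (Fin N) ℂ) ⊗ₖ copyMat))) i (j, b) = A i ((j, b), b) := by
  rw [Matrix.mul_apply, Finset.sum_eq_single ((j, b), b)]
  · simp [copyMat]
  · rintro ⟨⟨k, c⟩, d⟩ - h
    simp only [ne_eq, Prod.mk.injEq, not_and] at h
    simp [copyMat, Matrix.one_apply]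
    grind
  · simp

/-- Fixing the control values, `C(M) (A ⊗ I₂)` applies `1` or `M` to the columns of `A`. -/
theorem ctrlMat_mul_kronecker_one_apply {N : ℕ} {n : Type*} (M : Matrix (Fin N) (Fin N) ℂ)
    (A : Matrix (Fin N) n ℂ) (i : Fin N) (j : n) (b : Fin 2) :
    (ctrlMat M * (A ⊗ₖ (1 : Matrix (Fin 2) (Fin 2) ℂ))) i (j, b) =
      ∑ k, ctrlMat M i (k, b) * A k j := by
  simp [Matrix.mul_apply, Fintype.sum_prod_type, Matrix.one_apply]

theorem stmt0 (N : ℕ) (hN : 1 ≤ N) (M₁ M₂ : Matrix (Fin N) (Fin N) ℂ) :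
    ctrlMat M₁ * (ctrlMat M₂ ⊗ₖ (1 : Matrix (Fin 2) (Fin 2) ℂ)) *
      (Matrix.reindex (Equiv.prodAssoc (Fin N) (Fin 2) (Fin 2)).symm
        (Equiv.refl (Fin N × Fin 2))
        ((1 : Matrix (Fin N) (Fin N) ℂ) ⊗ₖ copyMat)) =
    ctrlMat (M₁ * M₂) := by
  ext i ⟨j, b⟩
  rw [mul_reindex_one_kronecker_copyMat, ctrlMat_mul_kronecker_one_apply]
  by_cases hb : b = 0 <;> simp [ctrlMat, hb, Matrix.mul_apply]
end

section
/- Let N ≥ 1, let M₁, M₂ be N×N complex matrices, and let c₁, c₂ ∈ ℂ. Then C(M₁) * (C(M₂) ⊗ I₂) * (I_N ⊗ ((D(c₂) ⊗ D(c₁)) * W)) = C(c₁·M₁ + c₂·M₂), up to the canonical re-indexing equivalences, where D(c) = diag(1, c) and the first tensor factor of the output of W feeds the control of C(M₂); i.e., splitting the control wire with the W generator and scaling the branches realizes the controlled matrix of the linear combination c₁M₁ + c₂M₂. -/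
open Matrix
open scoped Kronecker

/-- The W generator: `|0⟩ ↦ |00⟩`, `|1⟩ ↦ |01⟩ + |10⟩`. -/
noncomputable def Wmat : Matrix (Fin 2 × Fin 2) (Fin 2) ℂ :=
  fun ab c =>
    if c = 0 then (if ab = (0, 0) then 1 else 0)
    else if ab = (0, 1) ∨ ab = (1, 0) then 1 else 0

/-- `D(c) = diag(1, c)`. -/
noncomputable def Dmat (c : ℂ) : Matrix (Fin 2) (Fin 2) ℂ := !![1, 0; 0, c]

theorem Dmat_kronecker_Dmat_mul_Wmat_apply_zero (c d : ℂ) (a b : Fin 2) :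
    ((Dmat c ⊗ₖ Dmat d) * Wmat) (a, b) 0 = if a = 0 ∧ b = 0 then 1 else 0 := by
  fin_cases a <;> fin_cases b <;>
    simp [Matrix.mul_apply, Dmat, Wmat]

theorem Dmat_kronecker_Dmat_mul_Wmat_apply_one (c d : ℂ) (a b : Fin 2) :
    ((Dmat c ⊗ₖ Dmat d) * Wmat) (a, b) 1 =
      if a = 0 then (if b = 0 then 0 else d) else (if b = 0 then c else 0) := by
  fin_cases a <;> fin_cases b <;>
    simp [Matrix.mul_apply, Fintype.sum_prod_type, Fin.sum_univ_two, Dmat, Wmat]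

theorem ctrlMat_mul_ctrlMat_kronecker_one_apply {N : ℕ} (M₁ M₂ : Matrix (Fin N) (Fin N) ℂ)
    (i j : Fin N) (a b : Fin 2) :
    (ctrlMat M₁ * (ctrlMat M₂ ⊗ₖ (1 : Matrix (Fin 2) (Fin 2) ℂ))) i ((j, a), b) =
      if b = 0 then ctrlMat M₂ i (j, a) else ∑ k, M₁ i k * ctrlMat M₂ k (j, a) := by
  rw [Matrix.mul_apply, Fintype.sum_prod_type]
  fin_cases b <;> simp [Fin.sum_univ_two, ctrlMat.eq_def M₁]

theorem stmt1 (N : ℕ) (hN : 1 ≤ N) (M₁ M₂ : Matrix (Fin N) (Fin N) ℂ) (c₁ c₂ : ℂ) :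
    ctrlMat M₁ * (ctrlMat M₂ ⊗ₖ (1 : Matrix (Fin 2) (Fin 2) ℂ)) *
      (Matrix.reindex (Equiv.prodAssoc (Fin N) (Fin 2) (Fin 2)).symm
        (Equiv.refl (Fin N × Fin 2))
        ((1 : Matrix (Fin N) (Fin N) ℂ) ⊗ₖ ((Dmat c₂ ⊗ₖ Dmat c₁) * Wmat))) =
    ctrlMat (c₁ • M₁ + c₂ • M₂) := by
  ext i ⟨j, c⟩
  rw [Matrix.mul_apply, Fintype.sum_prod_type, Fintype.sum_prod_type]
  simp only [ctrlMat_mul_ctrlMat_kronecker_one_apply, Matrix.reindex_apply,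
    Matrix.submatrix_apply, Equiv.symm_symm, Equiv.prodAssoc_apply, Equiv.refl_symm,
    Equiv.refl_apply, Matrix.kroneckerMap_apply, Matrix.one_apply, Fin.sum_univ_two]
  fin_cases c
  · simp [Dmat_kronecker_Dmat_mul_Wmat_apply_zero, ctrlMat]
  · simp [Dmat_kronecker_Dmat_mul_Wmat_apply_one, ctrlMat, Finset.sum_add_distrib]
    ring
end

section
/- Let N ≥ 1 and let M be an N×N complex matrix. Then C(M) * (C(0) ⊗ I₂) * (I_N ⊗ W) = C(M), up to the canonical re-indexing equivalences, where 0 denotes the N×N zero matrix; i.e., the controlled matrix of the zero matrix is an additive identity for the W-based addition of controlled matrices. -/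
open Matrix
open scoped Kronecker

theorem stmt3 (N : ℕ) (hN : 1 ≤ N) (M : Matrix (Fin N) (Fin N) ℂ) :
    ctrlMat M * (ctrlMat (0 : Matrix (Fin N) (Fin N) ℂ) ⊗ₖ (1 : Matrix (Fin 2) (Fin 2) ℂ)) *
      (Matrix.reindex (Equiv.prodAssoc (Fin N) (Fin 2) (Fin 2)).symm
        (Equiv.refl (Fin N × Fin 2))
        ((1 : Matrix (Fin N) (Fin N) ℂ) ⊗ₖ Wmat)) =
    ctrlMat M := by
  ext i ⟨j, b⟩
  fin_cases b <;>
    simp [Matrix.mul_apply, Fintype.sum_prod_type, Fin.sum_univ_two, ctrlMat, Wmat,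
      Matrix.one_apply, ite_and]
end

section
/- Let N ≥ 1 and let M be an N×N complex matrix. Then C(M) * ((C(M) * (I_N ⊗ diag(1,−1))) ⊗ I₂) * (I_N ⊗ W) = C(0), up to the canonical re-indexing equivalences, where 0 is the N×N zero matrix; i.e., precomposing the control wire of the controlled matrix C(M) with the scalar gate diag(1,−1) produces an additive inverse of C(M) under the W-based addition of controlled matrices. -/
open Matrix
open scoped Kronecker

/-- The W-based sum of controlled matrices is the controlled matrix of the sum. -/
theorem ctrlMat_mul_kronecker_mul_W {N : ℕ} (A B : Matrix (Fin N) (Fin N) ℂ) :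
    ctrlMat A * (ctrlMat B ⊗ₖ (1 : Matrix (Fin 2) (Fin 2) ℂ)) *
      (Matrix.reindex (Equiv.prodAssoc (Fin N) (Fin 2) (Fin 2)).symm
        (Equiv.refl (Fin N × Fin 2))
        ((1 : Matrix (Fin N) (Fin N) ℂ) ⊗ₖ Wmat)) = ctrlMat (A + B) := by
  ext i ⟨j, b⟩
  fin_cases b <;>
    simp [Matrix.mul_apply, Fintype.sum_prod_type, Fin.sum_univ_two, Matrix.one_apply,
      ctrlMat, Wmat, Finset.sum_add_distrib, add_comm]

/-- Precomposing the control wire with `diag(1, -1)` negates the controlled matrix. -/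
theorem ctrlMat_mul_one_kronecker_diag {N : ℕ} (M : Matrix (Fin N) (Fin N) ℂ) :
    ctrlMat M * ((1 : Matrix (Fin N) (Fin N) ℂ) ⊗ₖ !![(1 : ℂ), 0; 0, -1]) = ctrlMat (-M) := by
  ext i ⟨j, b⟩
  fin_cases b <;>
    simp [Matrix.mul_apply, Fintype.sum_prod_type, Fin.sum_univ_two, Matrix.one_apply, ctrlMat]

theorem stmt4 (N : ℕ) (hN : 1 ≤ N) (M : Matrix (Fin N) (Fin N) ℂ) :
    ctrlMat M *
      ((ctrlMat M *
          ((1 : Matrix (Fin N) (Fin N) ℂ) ⊗ₖ !![(1 : ℂ), 0; 0, -1])) ⊗ₖ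
        (1 : Matrix (Fin 2) (Fin 2) ℂ)) *
      (Matrix.reindex (Equiv.prodAssoc (Fin N) (Fin 2) (Fin 2)).symm
        (Equiv.refl (Fin N × Fin 2))
        ((1 : Matrix (Fin N) (Fin N) ℂ) ⊗ₖ Wmat)) =
    ctrlMat (0 : Matrix (Fin N) (Fin N) ℂ) := by
  rw [ctrlMat_mul_one_kronecker_diag, ctrlMat_mul_kronecker_mul_W, add_neg_cancel]
end

section
/- Let N ≥ 1 and let M₁, M₂, M₃ be N×N complex matrices. Define Sum(A,B) := A * (B ⊗ I₂) * (I_N ⊗ W) and Prod(A,B) := A * (B ⊗ I₂) * (I_N ⊗ Δ) for A, B of type Matrix (Fin N) (Fin N × Fin 2) ℂ, up to the canonical re-indexing equivalences. Then Prod(C(M₁), Sum(C(M₂), C(M₃))) = Sum(Prod(C(M₁), C(M₂)), Prod(C(M₁), C(M₃))); i.e., the multiplication of controlled matrices distributes over their addition. -/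
open Matrix
open scoped Kronecker

/-- W-based addition of controlled matrices: `Sum(A,B) = A * (B ⊗ I₂) * (I_N ⊗ W)`
(up to the canonical re-indexing `(Fin N × Fin 2) × Fin 2 ≃ Fin N × (Fin 2 × Fin 2)`). -/
noncomputable def csum {N : ℕ} (A B : Matrix (Fin N) (Fin N × Fin 2) ℂ) :
    Matrix (Fin N) (Fin N × Fin 2) ℂ :=
  A * (B ⊗ₖ (1 : Matrix (Fin 2) (Fin 2) ℂ)) *
    (Matrix.reindex (Equiv.prodAssoc (Fin N) (Fin 2) (Fin 2)).symm
      (Equiv.refl (Fin N × Fin 2))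
      ((1 : Matrix (Fin N) (Fin N) ℂ) ⊗ₖ Wmat))

/-- Δ-based multiplication of controlled matrices: `Prod(A,B) = A * (B ⊗ I₂) * (I_N ⊗ Δ)`
(up to the canonical re-indexing `(Fin N × Fin 2) × Fin 2 ≃ Fin N × (Fin 2 × Fin 2)`). -/
noncomputable def cprod {N : ℕ} (A B : Matrix (Fin N) (Fin N × Fin 2) ℂ) :
    Matrix (Fin N) (Fin N × Fin 2) ℂ :=
  A * (B ⊗ₖ (1 : Matrix (Fin 2) (Fin 2) ℂ)) *
    (Matrix.reindex (Equiv.prodAssoc (Fin N) (Fin 2) (Fin 2)).symm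
      (Equiv.refl (Fin N × Fin 2))
      ((1 : Matrix (Fin N) (Fin N) ℂ) ⊗ₖ copyMat))

/-- Entries of `A * (B ⊗ I₂) * (I_N ⊗ G)` for a matrix `G` acting on the control bits. -/
lemma mul_kronecker_one_mul_reindex_apply {N : ℕ} (A B : Matrix (Fin N) (Fin N × Fin 2) ℂ)
    (G : Matrix (Fin 2 × Fin 2) (Fin 2) ℂ) (i k : Fin N) (e : Fin 2) :
    (A * (B ⊗ₖ (1 : Matrix (Fin 2) (Fin 2) ℂ)) *
      (Matrix.reindex (Equiv.prodAssoc (Fin N) (Fin 2) (Fin 2)).symm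
        (Equiv.refl (Fin N × Fin 2))
        ((1 : Matrix (Fin N) (Fin N) ℂ) ⊗ₖ G))) i (k, e) =
      ∑ d, ∑ c, (∑ j, A i (j, c) * B j (k, d)) * G (d, c) e := by
  simp [Matrix.mul_apply, Fintype.sum_prod_type, Matrix.one_apply, Finset.sum_add_distrib]

/-- Addition of controlled matrices controls the sum. -/
lemma csum_ctrlMat {N : ℕ} (A B : Matrix (Fin N) (Fin N) ℂ) :
    csum (ctrlMat A) (ctrlMat B) = ctrlMat (A + B) := by
  ext i ⟨k, e⟩
  rw [csum, mul_kronecker_one_mul_reindex_apply]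
  fin_cases e <;> simp [ctrlMat, Wmat]

/-- Multiplication of controlled matrices controls the product. -/
lemma cprod_ctrlMat {N : ℕ} (A B : Matrix (Fin N) (Fin N) ℂ) :
    cprod (ctrlMat A) (ctrlMat B) = ctrlMat (A * B) := by
  ext i ⟨k, e⟩
  rw [cprod, mul_kronecker_one_mul_reindex_apply]
  fin_cases e <;> simp [ctrlMat, copyMat, Matrix.mul_apply]

theorem stmt5 (N : ℕ) (hN : 1 ≤ N) (M₁ M₂ M₃ : Matrix (Fin N) (Fin N) ℂ) :
    cprod (ctrlMat M₁) (csum (ctrlMat M₂) (ctrlMat M₃)) =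
    csum (cprod (ctrlMat M₁) (ctrlMat M₂)) (cprod (ctrlMat M₁) (ctrlMat M₃)) := by
  simp only [csum_ctrlMat, cprod_ctrlMat, mul_add]
end

section
/- Let N ≥ 1. Let M̃_N := { A : Matrix (Fin N) (Fin N × Fin 2) ℂ | ∀ i j, A i (j,0) = if i = j then 1 else 0 } be the set of controlled matrices, with operations Sum(A,B) := A * (B ⊗ I₂) * (I_N ⊗ W) and Prod(A,B) := A * (B ⊗ I₂) * (I_N ⊗ Δ) (up to canonical re-indexing). Then: (i) the map M ↦ C(M) is a bijection from N×N complex matrices onto M̃_N; (ii) C(M₁ + M₂) = Sum(C(M₁), C(M₂)) and C(M₁ * M₂) = Prod(C(M₁), C(M₂)) for all M₁, M₂. Consequently M̃_N equipped with Sum and Prod is a (generally noncommutative) ring, with additive identity C(0) and multiplicative identity C(I_N), and C is a ring isomorphism from the matrix ring Matrix (Fin N) (Fin N) ℂ to M̃_N. -/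
open Matrix
open scoped Kronecker

/-- The set of controlled matrices: column `(j,0)` is the standard basis column `e_j`. -/
def ctrlSet (N : ℕ) : Set (Matrix (Fin N) (Fin N × Fin 2) ℂ) :=
  {A | ∀ i j, A i (j, 0) = if i = j then (1 : ℂ) else 0}

theorem ctrlMat_injective {N : ℕ} : Function.Injective (ctrlMat (N := N)) := by
  intro M₁ M₂ h
  ext i j
  simpa [ctrlMat] using congrFun (congrFun h i) (j, 1)

theorem range_ctrlMat {N : ℕ} : Set.range (ctrlMat (N := N)) = ctrlSet N := by
  ext A
  constructor
  · rintro ⟨M, rfl⟩ i j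
    simp [ctrlMat]
  · intro hA
    refine ⟨fun i j => A i (j, 1), ?_⟩
    ext i ⟨j, b⟩
    fin_cases b
    · simpa [ctrlMat] using (hA i j).symm
    · simp [ctrlMat]

theorem ctrlMat_add {N : ℕ} (M₁ M₂ : Matrix (Fin N) (Fin N) ℂ) :
    ctrlMat (M₁ + M₂) = csum (ctrlMat M₁) (ctrlMat M₂) := by
  ext i ⟨j, b⟩
  fin_cases b <;>
    simp [csum, ctrlMat, Wmat, Matrix.mul_apply, Matrix.one_apply, Fintype.sum_prod_type,
      Fin.sum_univ_two, Finset.sum_add_distrib, add_comm]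

theorem ctrlMat_mul {N : ℕ} (M₁ M₂ : Matrix (Fin N) (Fin N) ℂ) :
    ctrlMat (M₁ * M₂) = cprod (ctrlMat M₁) (ctrlMat M₂) := by
  ext i ⟨j, b⟩
  fin_cases b <;>
    simp [cprod, ctrlMat, copyMat, Matrix.mul_apply, Matrix.one_apply, Fintype.sum_prod_type,
      Fin.sum_univ_two]

/-- The controlled-matrix map as a bijection onto the set of controlled matrices. -/
noncomputable def ctrlEquiv (N : ℕ) : Matrix (Fin N) (Fin N) ℂ ≃ ctrlSet N :=
  (Equiv.ofInjective ctrlMat ctrlMat_injective).trans (Equiv.setCongr range_ctrlMat)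

theorem coe_ctrlEquiv {N : ℕ} (M : Matrix (Fin N) (Fin N) ℂ) :
    (ctrlEquiv N M : Matrix (Fin N) (Fin N × Fin 2) ℂ) = ctrlMat M :=
  rfl

theorem stmt6 (N : ℕ) (hN : 1 ≤ N) :
    -- (i) `M ↦ C(M)` is a bijection from `N × N` matrices onto the set of controlled matrices
    (Function.Injective (ctrlMat (N := N)) ∧ Set.range (ctrlMat (N := N)) = ctrlSet N) ∧
    -- (ii) `C` turns matrix addition and multiplication into `Sum` and `Prod`
    (∀ M₁ M₂ : Matrix (Fin N) (Fin N) ℂ, ctrlMat (M₁ + M₂) = csum (ctrlMat M₁) (ctrlMat M₂)) ∧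
    (∀ M₁ M₂ : Matrix (Fin N) (Fin N) ℂ, ctrlMat (M₁ * M₂) = cprod (ctrlMat M₁) (ctrlMat M₂)) ∧
    -- consequently, `ctrlSet N` with `Sum` and `Prod` is a ring, with additive identity
    -- `C(0)` and multiplicative identity `C(1)`, and `C` is a ring isomorphism onto it
    ∃ inst : Ring (ctrlSet N),
      letI := inst
      ∃ e : Matrix (Fin N) (Fin N) ℂ ≃+* (ctrlSet N),
        (∀ A B : ctrlSet N,
          ((A + B : ctrlSet N) : Matrix (Fin N) (Fin N × Fin 2) ℂ) = csum (A : Matrix (Fin N) (Fin N × Fin 2) ℂ) B) ∧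
        (∀ A B : ctrlSet N,
          ((A * B : ctrlSet N) : Matrix (Fin N) (Fin N × Fin 2) ℂ) = cprod (A : Matrix (Fin N) (Fin N × Fin 2) ℂ) B) ∧
        (((0 : ctrlSet N) : Matrix (Fin N) (Fin N × Fin 2) ℂ) = ctrlMat 0) ∧
        (((1 : ctrlSet N) : Matrix (Fin N) (Fin N × Fin 2) ℂ) = ctrlMat 1) ∧
        (∀ M : Matrix (Fin N) (Fin N) ℂ,
          ((e M : ctrlSet N) : Matrix (Fin N) (Fin N × Fin 2) ℂ) = ctrlMat M) := by
  refine ⟨⟨ctrlMat_injective, range_ctrlMat⟩, ctrlMat_add, ctrlMat_mul,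
    (ctrlEquiv N).symm.ring, ?_⟩
  let _ : Ring (ctrlSet N) := (ctrlEquiv N).symm.ring
  let e : Matrix (Fin N) (Fin N) ℂ ≃+* ctrlSet N := (ctrlEquiv N).symm.ringEquiv.symm
  have he (M) : (e M : Matrix (Fin N) (Fin N × Fin 2) ℂ) = ctrlMat M := coe_ctrlEquiv M
  refine ⟨e, fun A B => ?_, fun A B => ?_, ?_, ?_, he⟩
  · obtain ⟨M₁, rfl⟩ := e.surjective A
    obtain ⟨M₂, rfl⟩ := e.surjective B
    rw [← map_add, he, he, he, ctrlMat_add]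
  · obtain ⟨M₁, rfl⟩ := e.surjective A
    obtain ⟨M₂, rfl⟩ := e.surjective B
    rw [← map_mul, he, he, he, ctrlMat_mul]
  · rw [← map_zero e, he]
  · rw [← map_one e, he]
end

section
/- Let n ≥ 1 and let ψ, φ : (Fin n → Fin 2) → ℂ be n-qubit states. Then coWₙ * (S(ψ) ⊗ S(φ)) * W = S(ψ + φ), up to the canonical re-indexing equivalences; i.e., the diagrammatic addition ⊞ of controlled states (tensoring, feeding both controls from one W generator, and merging corresponding outputs pairwise with coW) realizes the controlled state of the pointwise sum ψ + φ. -/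
open Matrix
open scoped Kronecker

/-- The controlled state of an `n`-qubit state `ψ`: column `0` is the standard basis
vector at the all-zeros bitstring, column `1` is `ψ`. -/
noncomputable def cstate {n : ℕ} (ψ : (Fin n → Fin 2) → ℂ) :
    Matrix (Fin n → Fin 2) (Fin 2) ℂ :=
  fun s b => if b = 0 then (if s = 0 then 1 else 0) else ψ s

/-- The `n`-fold merging map: `coWₙ s (u,v) = ∏ i, coW (s i) (u i, v i)` where `coW = Wᵀ`. -/
noncomputable def coWn (n : ℕ) :
    Matrix (Fin n → Fin 2) ((Fin n → Fin 2) × (Fin n → Fin 2)) ℂ :=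
  fun s uv => ∏ i, Wmat.transpose (s i) (uv.1 i, uv.2 i)

theorem Wmat_transpose_zero_right (a b : Fin 2) :
    Wmat.transpose a (b, 0) = if b = a then 1 else 0 := by
  fin_cases a <;> fin_cases b <;> simp [Wmat]

theorem Wmat_transpose_zero_left (a b : Fin 2) :
    Wmat.transpose a (0, b) = if b = a then 1 else 0 := by
  fin_cases a <;> fin_cases b <;> simp [Wmat]

theorem coWn_zero_right {n : ℕ} (s u : Fin n → Fin 2) :
    coWn n s (u, 0) = if u = s then 1 else 0 := by
  simp [coWn, -Matrix.transpose_apply, Wmat_transpose_zero_right, Finset.prod_ite_zero,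
    funext_iff]

theorem coWn_zero_left {n : ℕ} (s v : Fin n → Fin 2) :
    coWn n s (0, v) = if v = s then 1 else 0 := by
  simp [coWn, -Matrix.transpose_apply, Wmat_transpose_zero_left, Finset.prod_ite_zero,
    funext_iff]

theorem coWn_mul_kronecker_cstate_zero_right {n : ℕ} (ψ φ : (Fin n → Fin 2) → ℂ)
    (s : Fin n → Fin 2) (b : Fin 2) :
    (coWn n * (cstate ψ ⊗ₖ cstate φ)) s (b, 0) = cstate ψ s b := by
  have h (v : Fin n → Fin 2) : cstate φ v 0 = if v = 0 then 1 else 0 := rfl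
  simp [Matrix.mul_apply, Fintype.sum_prod_type, h, coWn_zero_right]

theorem coWn_mul_kronecker_cstate_zero_left {n : ℕ} (ψ φ : (Fin n → Fin 2) → ℂ)
    (s : Fin n → Fin 2) (b : Fin 2) :
    (coWn n * (cstate ψ ⊗ₖ cstate φ)) s (0, b) = cstate φ s b := by
  have h (v : Fin n → Fin 2) : cstate ψ v 0 = if v = 0 then 1 else 0 := rfl
  rw [Matrix.mul_apply, Fintype.sum_prod_type_right]
  simp [h, coWn_zero_left]

theorem stmt7 (n : ℕ) (hn : 1 ≤ n) (ψ φ : (Fin n → Fin 2) → ℂ) :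
    coWn n * (cstate ψ ⊗ₖ cstate φ) * Wmat = cstate (ψ + φ) := by
  ext s c
  rw [Matrix.mul_apply, Fintype.sum_prod_type]
  simp only [Fin.sum_univ_two, coWn_mul_kronecker_cstate_zero_right,
    coWn_mul_kronecker_cstate_zero_left]
  fin_cases c
  · simp [Wmat, cstate]
  · simp [Wmat, cstate, add_comm]
end

section
/- Let n ≥ 1 and let ψ, φ : (Fin n → Fin 2) → ℂ be n-qubit states. Then coWₙ * (S(ψ) ⊗ S(φ)) * Δ = S(ψ ⊛ φ), up to the canonical re-indexing equivalences; i.e., the diagrammatic multiplication ⊠ of controlled states (tensoring, feeding both controls from one copy map Δ, and merging corresponding outputs pairwise with coW) realizes the controlled state of the disjoint convolution ψ ⊛ φ. -/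
open Matrix
open scoped Kronecker

/-- The disjoint convolution of two `n`-qubit states:
`(ψ ⊛ φ) s = ∑ ψ u * φ v` over pointwise-disjoint pairs `(u, v)` with pointwise `u ∨ v = s`. -/
noncomputable def dconv {n : ℕ} (ψ φ : (Fin n → Fin 2) → ℂ) : (Fin n → Fin 2) → ℂ :=
  fun s => ∑ u : Fin n → Fin 2, ∑ v : Fin n → Fin 2,
    if (∀ i, ¬(u i = 1 ∧ v i = 1)) ∧ (∀ i, max (u i) (v i) = s i) then ψ u * φ v else 0

theorem Wmat_transpose_apply (c a b : Fin 2) :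
    Wmat.transpose c (a, b) = if ¬(a = 1 ∧ b = 1) ∧ max a b = c then 1 else 0 := by
  fin_cases a <;> fin_cases b <;> fin_cases c <;> simp [Wmat]

theorem coWn_apply {n : ℕ} (s u v : Fin n → Fin 2) :
    coWn n s (u, v) =
      if (∀ i, ¬(u i = 1 ∧ v i = 1)) ∧ (∀ i, max (u i) (v i) = s i) then 1 else 0 := by
  simp only [coWn, Wmat_transpose_apply, Finset.prod_ite_zero, Finset.prod_const_one,
    Finset.mem_univ, forall_const, forall_and]

theorem mul_copyMat_apply {m : Type*} (A : Matrix m (Fin 2 × Fin 2) ℂ) (s : m) (c : Fin 2) :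
    (A * copyMat) s c = A s (c, c) := by
  rw [Matrix.mul_apply, Finset.sum_eq_single (c, c)]
  · simp [copyMat]
  · rintro ⟨a, b⟩ - h
    have h' : ¬(a = c ∧ b = c) := fun ⟨ha, hb⟩ => h (by rw [ha, hb])
    simp [copyMat, h']
  · simp

theorem stmt8 (n : ℕ) (hn : 1 ≤ n) (ψ φ : (Fin n → Fin 2) → ℂ) :
    coWn n * (cstate ψ ⊗ₖ cstate φ) * copyMat = cstate (dconv ψ φ) := by
  ext s c
  rw [mul_copyMat_apply, Matrix.mul_apply, Fintype.sum_prod_type]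
  simp only [coWn_apply, Matrix.kroneckerMap_apply, ite_mul, one_mul, zero_mul]
  by_cases hc : c = 0
  · subst hc
    simp only [cstate, if_true]
    rw [Finset.sum_eq_single 0, Finset.sum_eq_single 0]
    · simp [funext_iff, eq_comm]
    · intro v _ hv
      simp [hv]
    · simp
    · intro u _ hu
      simp [hu]
    · simp
  · simp only [cstate, hc, if_false, dconv]
end

section
/- Let n ≥ 1 and let ψ₁, ψ₂ : (Fin n → Fin 2) → ℂ be n-qubit states. Then coWₙ * (S(ψ₁) ⊗ S(ψ₂)) * W = coWₙ * (S(ψ₂) ⊗ S(ψ₁)) * W, up to the canonical re-indexing equivalences; i.e., the diagrammatic addition ⊞ of controlled states is commutative: S(ψ₁) ⊞ S(ψ₂) = S(ψ₂) ⊞ S(ψ₁). -/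
open Matrix
open scoped Kronecker

theorem Wmat_swap (p : Fin 2 × Fin 2) (c : Fin 2) : Wmat p.swap c = Wmat p c := by
  obtain ⟨a, b⟩ := p
  fin_cases a <;> fin_cases b <;> simp [Wmat]

theorem Wmat_submatrix_prodComm :
    Wmat.submatrix (Equiv.prodComm (Fin 2) (Fin 2)) id = Wmat := by
  ext p c
  exact Wmat_swap p c

theorem coWn_submatrix_prodComm (n : ℕ) :
    (coWn n).submatrix id (Equiv.prodComm (Fin n → Fin 2) (Fin n → Fin 2)) = coWn n := by
  ext s uv
  simp only [coWn, Matrix.submatrix_apply, Matrix.transpose_apply]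
  exact Finset.prod_congr rfl fun i _ => Wmat_swap (uv.1 i, uv.2 i) (s i)

theorem kronecker_submatrix_prodComm {l m p q R : Type*} [CommMagma R]
    (A : Matrix l m R) (B : Matrix p q R) :
    (A ⊗ₖ B).submatrix (Equiv.prodComm p l) (Equiv.prodComm q m) = B ⊗ₖ A := by
  ext i j
  exact mul_comm _ _

theorem stmt9 (n : ℕ) (hn : 1 ≤ n) (ψ₁ ψ₂ : (Fin n → Fin 2) → ℂ) :
    coWn n * (cstate ψ₁ ⊗ₖ cstate ψ₂) * Wmat =
    coWn n * (cstate ψ₂ ⊗ₖ cstate ψ₁) * Wmat := by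
  rw [← kronecker_submatrix_prodComm (cstate ψ₁) (cstate ψ₂)]
  nth_rewrite 2 [← coWn_submatrix_prodComm n]
  nth_rewrite 2 [← Wmat_submatrix_prodComm]
  simp only [Matrix.submatrix_mul_equiv, Matrix.submatrix_id_id]
end

section
/- Let n ≥ 1 and let ψ : (Fin n → Fin 2) → ℂ be an n-qubit state. Then coWₙ * (S(ψ) ⊗ S(0)) * W = S(ψ), up to the canonical re-indexing equivalences, where 0 is the zero state; i.e., the controlled state of the zero state is an additive identity for the diagrammatic addition ⊞ of controlled states. -/
open Matrix
open scoped Kronecker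

theorem Wmat_apply_zero_right (a c : Fin 2) : Wmat (a, 0) c = if c = a then 1 else 0 := by
  fin_cases a <;> fin_cases c <;> simp [Wmat]

theorem coWn_apply_zero_right {n : ℕ} (s u : Fin n → Fin 2) :
    coWn n s (u, 0) = if s = u then 1 else 0 := by
  simp [coWn, Wmat_apply_zero_right, Finset.prod_ite_zero, funext_iff]

theorem cstate_zero_apply {n : ℕ} (v : Fin n → Fin 2) (b : Fin 2) :
    cstate (0 : (Fin n → Fin 2) → ℂ) v b = if v = 0 then (if b = 0 then 1 else 0) else 0 := by
  by_cases hb : b = 0 <;> simp [cstate, hb]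

/-- Merging with the controlled zero state projects the second control onto `|0⟩`. -/
theorem coWn_mul_kronecker_cstate_zero_apply {n : ℕ} (M : Matrix (Fin n → Fin 2) (Fin 2) ℂ)
    (s : Fin n → Fin 2) (a b : Fin 2) :
    (coWn n * (M ⊗ₖ cstate (0 : (Fin n → Fin 2) → ℂ))) s (a, b) =
      if b = 0 then M s a else 0 := by
  simp [Matrix.mul_apply, Fintype.sum_prod_type, cstate_zero_apply, coWn_apply_zero_right]

theorem stmt11 (n : ℕ) (hn : 1 ≤ n) (ψ : (Fin n → Fin 2) → ℂ) :
    coWn n * (cstate ψ ⊗ₖ cstate (0 : (Fin n → Fin 2) → ℂ)) * Wmat = cstate ψ := by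
  refine Matrix.ext fun s c => ?_
  rw [Matrix.mul_apply]
  simp [Fintype.sum_prod_type, coWn_mul_kronecker_cstate_zero_apply,
    Wmat_apply_zero_right]
end
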